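/- arXiv:2502.03847 — 4 statements merged into one kernel-verified Lean document; each statement's English description precedes it below -/
import Mathlib

section
/- For every integer q with 1 ≤ q ≤ 5 there exists a real number η with 0 ≤ η < 1 such that for every ζ ∈ ℂ with |ζ| < 1 one has Re( δ(ζ) / (1 − η·ζ) ) > 0, where δ(ζ) = Σ_{l=1}^{q} (1/l)(1−ζ)^l. -/
/-- Reduction to the boundary via the strong maximum principle for `exp (-f)`. -/
theorem re_pos_of_boundary (δ : ℂ → ℂ) (η : ℝ) (h0 : 0 ≤ η) (h1 : η < 1)
    (hd : Differentiable ℂ δ) (hp : 0 < (δ 0).re)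
    (hb : ∀ x y : ℝ, x ^ 2 + y ^ 2 = 1 →
      0 ≤ (δ ⟨x, y⟩).re * (1 - η * x) - (δ ⟨x, y⟩).im * (η * y))
    (ζ : ℂ) (hζ : ‖ζ‖ < 1) : 0 < (δ ζ / (1 - (η : ℂ) * ζ)).re := by
  have hne : ∀ z : ℂ, ‖z‖ ≤ 1 → 1 - (η : ℂ) * z ≠ 0 := by
    intro z hz1 h
    have h2 : (η : ℂ) * z = 1 := (sub_eq_zero.mp h).symm
    have h3 : η * ‖z‖ = 1 := by
      have := congrArg norm h2
      rwa [norm_mul, norm_one, Complex.norm_real, Real.norm_of_nonneg h0] at this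
    nlinarith [norm_nonneg z]
  let g : ℂ → ℂ := fun z => Complex.exp (-(δ z / (1 - (η : ℂ) * z)))
  have hgd : ∀ z : ℂ, ‖z‖ ≤ 1 → DifferentiableAt ℂ g z := by
    intro z hz1
    have := hne z hz1
    have := hd z
    fun_prop (disch := assumption)
  have hcl : closure (Metric.ball (0 : ℂ) 1) = Metric.closedBall 0 1 :=
    closure_ball 0 one_ne_zero
  have hdc : DiffContOnCl ℂ g (Metric.ball 0 1) := by
    apply DifferentiableOn.diffContOnCl
    rw [hcl]
    intro z hz1
    exact (hgd z (by simpa using hz1)).differentiableWithinAt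
  have hfr : ∀ z ∈ frontier (Metric.ball (0 : ℂ) 1), ‖g z‖ ≤ 1 := by
    intro z hz1
    rw [frontier_ball 0 one_ne_zero] at hz1
    have hz2 : ‖z‖ = 1 := by simpa using hz1
    have hz3 : z.re ^ 2 + z.im ^ 2 = 1 := by
      have := Complex.sq_norm z
      rw [hz2, Complex.normSq_apply] at this
      linarith
    have hbz := hb z.re z.im hz3
    have : (δ z / (1 - (η : ℂ) * z)).re =
        ((δ z).re * (1 - η * z.re) - (δ z).im * (η * z.im)) /
          Complex.normSq (1 - (η : ℂ) * z) := by
      rw [Complex.div_re]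
      simp
      ring
    simp only [g, Complex.norm_exp, Complex.neg_re, Real.exp_le_one_iff, this, neg_nonpos]
    exact div_nonneg hbz (Complex.normSq_nonneg _)
  have hle : ∀ z : ℂ, ‖z‖ ≤ 1 → ‖g z‖ ≤ 1 := by
    intro z hz1
    refine Complex.norm_le_of_forall_mem_frontier_norm_le Metric.isBounded_ball hdc hfr ?_
    rw [hcl]; simpa using hz1
  by_contra hneg
  have hg1 : ‖g ζ‖ = 1 := by
    refine le_antisymm (hle ζ hζ.le) ?_
    simp only [g, Complex.norm_exp, Complex.neg_re, Real.one_le_exp_iff]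
    linarith
  have hmax : IsMaxOn (norm ∘ g) (Metric.ball 0 1) ζ := by
    intro z hz1
    have : ‖z‖ < 1 := by simpa using hz1
    simpa [hg1] using hle z this.le
  have heq := Complex.eqOn_closure_of_isPreconnected_of_isMaxOn_norm
    (convex_ball (0 : ℂ) 1).isPreconnected Metric.isOpen_ball hdc
    (by simpa using hζ) hmax
  have e0 : ‖g 0‖ = 1 := by
    rw [heq (by rw [hcl]; simp)]; simpa using hg1
  simp [g, Complex.norm_exp] at e0
  linarith

theorem bdf_multiplier_property (q : ℕ) (hq1 : 1 ≤ q) (hq5 : q ≤ 5) :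
    ∃ η : ℝ, 0 ≤ η ∧ η < 1 ∧
      ∀ ζ : ℂ, ‖ζ‖ < 1 →
        0 < ((∑ l ∈ Finset.Icc 1 q, (l : ℂ)⁻¹ * (1 - ζ) ^ l) / (1 - (η : ℂ) * ζ)).re := by
  refine ⟨9 / 10, by norm_num, by norm_num, ?_⟩
  refine re_pos_of_boundary (fun ζ => ∑ l ∈ Finset.Icc 1 q, (l : ℂ)⁻¹ * (1 - ζ) ^ l) (9 / 10)
    (by norm_num) (by norm_num) (by fun_prop) ?_ ?_
  · interval_cases q <;> norm_num [Finset.sum_Icc_succ_top]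
  · intro x y h
    have hx1 : x ≤ 1 := by nlinarith
    have hx2 : -1 ≤ x := by nlinarith
    have hy : y ^ 2 = 1 - x ^ 2 := by linarith
    have hy4 : y ^ 4 = (1 - x ^ 2) ^ 2 := by rw [← hy]; ring
    have hy6 : y ^ 6 = (1 - x ^ 2) ^ 3 := by rw [← hy]; ring
    have hx : 0 ≤ 1 - x := by linarith
    have inv_re : ∀ n : ℕ, ((n : ℂ)⁻¹).re = (n : ℝ)⁻¹ := fun n => by
      rw [← Complex.ofReal_natCast, ← Complex.ofReal_inv, Complex.ofReal_re]
    have inv_im : ∀ n : ℕ, ((n : ℂ)⁻¹).im = 0 := fun n => by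
      rw [← Complex.ofReal_natCast, ← Complex.ofReal_inv, Complex.ofReal_im]
    have p2 : 0 ≤ 14 / 5 - x := by linarith
    have p3 : 0 ≤ 41 / 15 - 34 / 15 * x + 4 / 3 * x ^ 2 := by nlinarith [sq_nonneg (x - 17 / 20)]
    have p4 : 0 ≤ 26 / 15 - 13 / 6 * x + 127 / 30 * x ^ 2 - 2 * x ^ 3 := by
      nlinarith [sq_nonneg (x - 1 / 3), mul_nonneg (sq_nonneg x) hx]
    have p5 : 0 ≤ 16 / 75 + 31 / 30 * x + 839 / 150 * x ^ 2 - 206 / 25 * x ^ 3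
        + 16 / 5 * x ^ 4 := by
      nlinarith [sq_nonneg (x + 2 / 25), sq_nonneg (x ^ 2 - 5 / 4 * x), sq_nonneg x,
        sq_nonneg (x ^ 2 - x), mul_nonneg (sq_nonneg x) hx, sq_nonneg (x ^ 2 - 13 / 10 * x - 1 / 10)]
    interval_cases q <;>
      simp only [Finset.sum_Icc_succ_top, Finset.Icc_self, Finset.sum_singleton, pow_succ,
        pow_zero, one_mul, Complex.add_re, Complex.add_im, Complex.mul_re, Complex.mul_im,
        Complex.sub_re, Complex.sub_im, Complex.one_re, Complex.one_im, inv_re, inv_im,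
        Nat.reduceLeDiff, Nat.reduceAdd]
    · refine le_of_le_of_eq (mul_nonneg hx (by norm_num : (0 : ℝ) ≤ 19 / 10)) ?_
      push_cast
      ring_nf
      simp only [hy, hy4, hy6]
      ring
    · refine le_of_le_of_eq (mul_nonneg hx p2) ?_
      push_cast
      ring_nf
      simp only [hy, hy4, hy6]
      ring
    · refine le_of_le_of_eq (mul_nonneg hx p3) ?_
      push_cast
      ring_nf
      simp only [hy, hy4, hy6]
      ring
    · refine le_of_le_of_eq (mul_nonneg hx p4) ?_
      push_cast
      ring_nf
      simp only [hy, hy4, hy6]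
      ring
    · refine le_of_le_of_eq (mul_nonneg hx p5) ?_
      push_cast
      ring_nf
      simp only [hy, hy4, hy6]
      ring
end

section
/- For q ∈ {1, 2} and every ζ ∈ ℂ with |ζ| < 1, one has Re( Σ_{l=1}^{q} (1/l)(1−ζ)^l ) > 0; that is, the BDF-1 and BDF-2 generating polynomials have positive real part on the open unit disk (the multiplier η = 0 suffices for q = 1, 2). -/
/-- For `q ∈ {1, 2}` the BDF-`q` generating polynomial
`δ(ζ) = Σ_{l=1}^{q} (1/l)(1−ζ)^l` has positive real part on the open unit disk
(the multiplier `η = 0` suffices for `q = 1, 2`). -/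
theorem bdf12_positive_real_part (q : ℕ) (hq : q = 1 ∨ q = 2) (ζ : ℂ)
    (hζ : ‖ζ‖ < 1) :
    0 < (∑ l ∈ Finset.Icc 1 q, (l : ℂ)⁻¹ * (1 - ζ) ^ l).re := by
  have h : ζ.re * ζ.re + ζ.im * ζ.im < 1 := by
    rw [← Complex.normSq_apply, Complex.normSq_eq_norm_sq]
    nlinarith [norm_nonneg ζ]
  rcases hq with rfl | rfl
  · simp
    nlinarith [mul_self_nonneg ζ.im]
  · have e : (∑ l ∈ Finset.Icc (1 : ℕ) 2, (l : ℂ)⁻¹ * (1 - ζ) ^ l)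
        = (1 - ζ) + ((1 / 2 : ℝ) : ℂ) * ((1 - ζ) * (1 - ζ)) := by
      rw [show Finset.Icc 1 2 = ({1, 2} : Finset ℕ) from rfl, Finset.sum_pair (by norm_num)]
      push_cast
      ring
    rw [e, Complex.add_re, Complex.re_ofReal_mul, Complex.mul_re]
    simp only [Complex.sub_re, Complex.sub_im, Complex.one_re, Complex.one_im]
    nlinarith [mul_self_nonneg (1 - ζ.re)]
end

section
/- For every integer q with 1 ≤ q ≤ 5 there exist a real number η with 0 ≤ η < 1 and a symmetric positive definite matrix G = (g_{ij}) ∈ ℝ^{q×q} such that for every real vector space V equipped with a symmetric positive semidefinite bilinear form b : V × V → ℝ and all w_0, w_1, …, w_q ∈ V, one has b( Σ_{i=0}^{q} δ_i w_{q−i} , w_q − η·w_{q−1} ) ≥ Σ_{i,j=1}^{q} g_{ij} b(w_i, w_j) − Σ_{i,j=1}^{q} g_{ij} b(w_{i−1}, w_{j−1}), where δ_0,…,δ_q are the BDF-q coefficients. -/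
set_option linter.all false

/-- The BDF-`q` generating polynomial `δ(ζ) = Σ_{l=1}^{q} (1/l)(1−ζ)^l`, over `ℝ`. -/
noncomputable def bdfPoly (q : ℕ) : Polynomial ℝ :=
  ∑ l ∈ Finset.Icc 1 q, Polynomial.C ((l : ℝ)⁻¹) * (1 - Polynomial.X) ^ l

/-- The BDF-`q` coefficients `δ_j`, defined by `δ(ζ) = Σ_{j=0}^{q} δ_j ζ^j`. -/
noncomputable def bdfCoeff (q j : ℕ) : ℝ := (bdfPoly q).coeff j


open Polynomial in
lemma coeff_one_sub_X_pow_aux (l j : ℕ) :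
    ((1 - X : ℝ[X]) ^ l).coeff j = (-1) ^ j * (l.choose j : ℝ) := by
  have h : (1 - X : ℝ[X]) ^ l = ((1 + X) ^ l : ℝ[X]).comp (C (-1) * X) := by
    simp [sub_eq_add_neg]
  rw [h, comp_C_mul_X_coeff, coeff_one_add_X_pow]
  ring

lemma bdfCoeff_eq (q j : ℕ) :
    bdfCoeff q j = ∑ l ∈ Finset.Icc 1 q, (l : ℝ)⁻¹ * ((-1) ^ j * (l.choose j : ℝ)) := by
  simp [bdfCoeff, bdfPoly, Polynomial.finsetSum_coeff, Polynomial.coeff_C_mul,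
    coeff_one_sub_X_pow_aux]

lemma posDef_of_quad {n : ℕ} {G : Matrix (Fin n) (Fin n) ℝ} (hG : G.IsSymm)
    (h : ∀ x : Fin n → ℝ, x ≠ 0 → 0 < ∑ i, ∑ j, G i j * (x i * x j)) : G.PosDef := by
  refine Matrix.PosDef.of_dotProduct_mulVec_pos (by
    rw [Matrix.IsHermitian, Matrix.conjTranspose_eq_transpose_of_trivial]; exact hG) ?_
  intro x hx
  have e : star x ⬝ᵥ G.mulVec x = ∑ i, ∑ j, G i j * (x i * x j) := by
    simp only [dotProduct, Matrix.mulVec, Finset.mul_sum, star_trivial]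
    exact Finset.sum_congr rfl fun i _ => Finset.sum_congr rfl fun j _ => by ring
  rw [e]
  exact h x hx

/-- A Dahlquist matrix for BDF-1 with multiplier `η = 39/40`. -/
noncomputable def dahlquistG1 : Matrix (Fin 1) (Fin 1) ℝ :=
  !![1/80]

lemma dahlquistG1_isSymm : dahlquistG1.IsSymm := by
  ext i j
  fin_cases i <;> fin_cases j <;> simp [dahlquistG1]

lemma dahlquistG1_posDef : dahlquistG1.PosDef := by
  refine posDef_of_quad dahlquistG1_isSymm fun x hx => ?_
  have key : ∑ i, ∑ j, dahlquistG1 i j * (x i * x j) =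
      (1/80) * ((1) * x 0) ^ 2 := by
    simp [dahlquistG1, Fin.sum_univ_succ]
    ring
  by_contra hneg
  rw [key] at hneg
  apply hx
  have s0 := sq_nonneg ((1) * x 0)
  have z0 : ((1) * x 0) = 0 :=
    pow_eq_zero_iff two_ne_zero |>.1 (le_antisymm (by linarith) s0)
  have y0 : x 0 = 0 := by linarith
  ext i
  fin_cases i <;> simpa

lemma bdf1_ineq (V : Type*) [AddCommGroup V] [Module ℝ V] (b : V →ₗ[ℝ] V →ₗ[ℝ] ℝ)
    (hs : ∀ v w : V, b v w = b w v) (hp : ∀ v : V, 0 ≤ b v v) (w : ℕ → V) :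
    (∑ i : Fin 1, ∑ j : Fin 1, dahlquistG1 i j * b (w (i.1 + 1)) (w (j.1 + 1)))
        - ∑ i : Fin 1, ∑ j : Fin 1, dahlquistG1 i j * b (w i.1) (w j.1)
      ≤ b (∑ i ∈ Finset.range (1 + 1), bdfCoeff 1 i • w (1 - i))
          (w 1 - (39 / 40 : ℝ) • w (1 - 1)) := by
  have c0 : bdfCoeff 1 0 = 1 := by
    rw [bdfCoeff_eq]; norm_num [Finset.sum_Icc_succ_top, Nat.choose]
  have c1 : bdfCoeff 1 1 = -1 := by
    rw [bdfCoeff_eq]; norm_num [Finset.sum_Icc_succ_top, Nat.choose]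
  have h0 := hp ((1 : ℝ) • (w 1 - w 0))
  simp only [map_add, map_sub, map_smul, LinearMap.add_apply, LinearMap.sub_apply,
    LinearMap.smul_apply, smul_eq_mul, hs (w 1) (w 0)] at h0
  simp [dahlquistG1, Fin.sum_univ_succ, Finset.sum_range_succ, c0, c1, hs (w 1) (w 0)]
  linarith [mul_nonneg (by norm_num : (0:ℝ) ≤ 79/80) h0]

/-- A Dahlquist matrix for BDF-2 with multiplier `η = 39/40`. -/
noncomputable def dahlquistG2 : Matrix (Fin 2) (Fin 2) ℝ :=
  !![99/80, -199/160;
    -199/160, 101/80]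

lemma dahlquistG2_isSymm : dahlquistG2.IsSymm := by
  ext i j
  fin_cases i <;> fin_cases j <;> simp [dahlquistG2]

lemma dahlquistG2_posDef : dahlquistG2.PosDef := by
  refine posDef_of_quad dahlquistG2_isSymm fun x hx => ?_
  have key : ∑ i, ∑ j, dahlquistG2 i j * (x i * x j) =
      (99/80) * ((1) * x 0 + (-199/198) * x 1) ^ 2 +
      (79/6336) * ((1) * x 1) ^ 2 := by
    simp [dahlquistG2, Fin.sum_univ_succ]
    ring
  by_contra hneg
  rw [key] at hneg
  apply hx
  have s0 := sq_nonneg ((1) * x 0 + (-199/198) * x 1)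
  have s1 := sq_nonneg ((1) * x 1)
  have z1 : ((1) * x 1) = 0 :=
    pow_eq_zero_iff two_ne_zero |>.1 (le_antisymm (by linarith) s1)
  have z0 : ((1) * x 0 + (-199/198) * x 1) = 0 :=
    pow_eq_zero_iff two_ne_zero |>.1 (le_antisymm (by linarith) s0)
  have y1 : x 1 = 0 := by linarith
  have y0 : x 0 = 0 := by linarith
  ext i
  fin_cases i <;> simpa

lemma bdf2_ineq (V : Type*) [AddCommGroup V] [Module ℝ V] (b : V →ₗ[ℝ] V →ₗ[ℝ] ℝ)
    (hs : ∀ v w : V, b v w = b w v) (hp : ∀ v : V, 0 ≤ b v v) (w : ℕ → V) :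
    (∑ i : Fin 2, ∑ j : Fin 2, dahlquistG2 i j * b (w (i.1 + 1)) (w (j.1 + 1)))
        - ∑ i : Fin 2, ∑ j : Fin 2, dahlquistG2 i j * b (w i.1) (w j.1)
      ≤ b (∑ i ∈ Finset.range (2 + 1), bdfCoeff 2 i • w (2 - i))
          (w 2 - (39 / 40 : ℝ) • w (2 - 1)) := by
  have c0 : bdfCoeff 2 0 = 3/2 := by
    rw [bdfCoeff_eq]; norm_num [Finset.sum_Icc_succ_top, Nat.choose]
  have c1 : bdfCoeff 2 1 = -2 := by
    rw [bdfCoeff_eq]; norm_num [Finset.sum_Icc_succ_top, Nat.choose]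
  have c2 : bdfCoeff 2 2 = 1/2 := by
    rw [bdfCoeff_eq]; norm_num [Finset.sum_Icc_succ_top, Nat.choose]
  have h0 := hp ((1 : ℝ) • (w 1 - w 0) + (-20/99 : ℝ) • (w 2 - w 1))
  have h1 := hp ((1 : ℝ) • (w 2 - w 1))
  simp only [map_add, map_sub, map_smul, LinearMap.add_apply, LinearMap.sub_apply,
    LinearMap.smul_apply, smul_eq_mul, hs (w 1) (w 0), hs (w 2) (w 0), hs (w 2) (w 1)] at h0 h1
  simp [dahlquistG2, Fin.sum_univ_succ, Finset.sum_range_succ, c0, c1, c2, hs (w 1) (w 0), hs (w 2) (w 0), hs (w 2) (w 1)]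
  linarith [mul_nonneg (by norm_num : (0:ℝ) ≤ 99/80) h0, mul_nonneg (by norm_num : (0:ℝ) ≤ 1481/7920) h1]

/-- A Dahlquist matrix for BDF-3 with multiplier `η = 39/40`. -/
noncomputable def dahlquistG3 : Matrix (Fin 3) (Fin 3) ℝ :=
  !![71/60, -827/480, 87/160;
    -827/480, 931/240, -521/240;
    87/160, -521/240, 33/20]

lemma dahlquistG3_isSymm : dahlquistG3.IsSymm := by
  ext i j
  fin_cases i <;> fin_cases j <;> simp [dahlquistG3]

lemma dahlquistG3_posDef : dahlquistG3.PosDef := by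
  refine posDef_of_quad dahlquistG3_isSymm fun x hx => ?_
  have key : ∑ i, ∑ j, dahlquistG3 i j * (x i * x j) =
      (71/60) * ((1) * x 0 + (-827/568) * x 1 + (261/568) * x 2) ^ 2 +
      (373687/272640) * ((1) * x 1 + (-376009/373687) * x 2) ^ 2 +
      (1114999/89684880) * ((1) * x 2) ^ 2 := by
    simp [dahlquistG3, Fin.sum_univ_succ]
    ring
  by_contra hneg
  rw [key] at hneg
  apply hx
  have s0 := sq_nonneg ((1) * x 0 + (-827/568) * x 1 + (261/568) * x 2)
  have s1 := sq_nonneg ((1) * x 1 + (-376009/373687) * x 2)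
  have s2 := sq_nonneg ((1) * x 2)
  have z2 : ((1) * x 2) = 0 :=
    pow_eq_zero_iff two_ne_zero |>.1 (le_antisymm (by linarith) s2)
  have z1 : ((1) * x 1 + (-376009/373687) * x 2) = 0 :=
    pow_eq_zero_iff two_ne_zero |>.1 (le_antisymm (by linarith) s1)
  have z0 : ((1) * x 0 + (-827/568) * x 1 + (261/568) * x 2) = 0 :=
    pow_eq_zero_iff two_ne_zero |>.1 (le_antisymm (by linarith) s0)
  have y2 : x 2 = 0 := by linarith
  have y1 : x 1 = 0 := by linarith
  have y0 : x 0 = 0 := by linarith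
  ext i
  fin_cases i <;> simpa

lemma bdf3_ineq (V : Type*) [AddCommGroup V] [Module ℝ V] (b : V →ₗ[ℝ] V →ₗ[ℝ] ℝ)
    (hs : ∀ v w : V, b v w = b w v) (hp : ∀ v : V, 0 ≤ b v v) (w : ℕ → V) :
    (∑ i : Fin 3, ∑ j : Fin 3, dahlquistG3 i j * b (w (i.1 + 1)) (w (j.1 + 1)))
        - ∑ i : Fin 3, ∑ j : Fin 3, dahlquistG3 i j * b (w i.1) (w j.1)
      ≤ b (∑ i ∈ Finset.range (3 + 1), bdfCoeff 3 i • w (3 - i))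
          (w 3 - (39 / 40 : ℝ) • w (3 - 1)) := by
  have c0 : bdfCoeff 3 0 = 11/6 := by
    rw [bdfCoeff_eq]; norm_num [Finset.sum_Icc_succ_top, Nat.choose]
  have c1 : bdfCoeff 3 1 = -3 := by
    rw [bdfCoeff_eq]; norm_num [Finset.sum_Icc_succ_top, Nat.choose]
  have c2 : bdfCoeff 3 2 = 3/2 := by
    rw [bdfCoeff_eq]; norm_num [Finset.sum_Icc_succ_top, Nat.choose]
  have c3 : bdfCoeff 3 3 = -1/3 := by
    rw [bdfCoeff_eq]; norm_num [Finset.sum_Icc_succ_top, Nat.choose]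
  have h0 := hp ((1 : ℝ) • (w 1 - w 0) + (-259/568 : ℝ) • (w 2 - w 1) + (10/71 : ℝ) • (w 3 - w 2))
  have h1 := hp ((1 : ℝ) • (w 2 - w 1) + (9928/51063 : ℝ) • (w 3 - w 2))
  have h2 := hp ((1 : ℝ) • (w 3 - w 2))
  simp only [map_add, map_sub, map_smul, LinearMap.add_apply, LinearMap.sub_apply,
    LinearMap.smul_apply, smul_eq_mul, hs (w 1) (w 0), hs (w 2) (w 0), hs (w 3) (w 0), hs (w 2) (w 1), hs (w 3) (w 1), hs (w 3) (w 2)] at h0 h1 h2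
  simp [dahlquistG3, Fin.sum_univ_succ, Finset.sum_range_succ, c0, c1, c2, c3, hs (w 1) (w 0), hs (w 2) (w 0), hs (w 3) (w 0), hs (w 2) (w 1), hs (w 3) (w 1), hs (w 3) (w 2)]
  linarith [mul_nonneg (by norm_num : (0:ℝ) ≤ 71/60) h0, mul_nonneg (by norm_num : (0:ℝ) ≤ 17021/90880) h1, mul_nonneg (by norm_num : (0:ℝ) ≤ 234041/1531890) h2]

/-- A Dahlquist matrix for BDF-4 with multiplier `η = 39/40`. -/
noncomputable def dahlquistG4 : Matrix (Fin 4) (Fin 4) ℝ :=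
  !![727/640, -9803/5760, 6251/5760, -1003/1920;
    -9803/5760, 21829/5760, -2233/640, 8149/5760;
    6251/5760, -2233/640, 5983/1152, -16207/5760;
    -1003/1920, 8149/5760, -16207/5760, 3739/1920]

lemma dahlquistG4_isSymm : dahlquistG4.IsSymm := by
  ext i j
  fin_cases i <;> fin_cases j <;> simp [dahlquistG4]

lemma dahlquistG4_posDef : dahlquistG4.PosDef := by
  refine posDef_of_quad dahlquistG4_isSymm fun x hx => ?_
  have key : ∑ i, ∑ j, dahlquistG4 i j * (x i * x j) =
      (727/640) * ((1) * x 0 + (-9803/6543) * x 1 + (6251/6543) * x 2 + (-1003/2181) * x 3) ^ 2 +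
      (23364169/18843840) * ((1) * x 1 + (-35108059/23364169) * x 2 + (11910840/23364169) * x 3) ^ 2 +
      (30440982553/22429602240) * ((1) * x 2 + (-30612790391/30440982553) * x 3) ^ 2 +
      (180963562813/14611671625440) * ((1) * x 3) ^ 2 := by
    simp [dahlquistG4, Fin.sum_univ_succ]
    ring
  by_contra hneg
  rw [key] at hneg
  apply hx
  have s0 := sq_nonneg ((1) * x 0 + (-9803/6543) * x 1 + (6251/6543) * x 2 + (-1003/2181) * x 3)
  have s1 := sq_nonneg ((1) * x 1 + (-35108059/23364169) * x 2 + (11910840/23364169) * x 3)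
  have s2 := sq_nonneg ((1) * x 2 + (-30612790391/30440982553) * x 3)
  have s3 := sq_nonneg ((1) * x 3)
  have z3 : ((1) * x 3) = 0 :=
    pow_eq_zero_iff two_ne_zero |>.1 (le_antisymm (by linarith) s3)
  have z2 : ((1) * x 2 + (-30612790391/30440982553) * x 3) = 0 :=
    pow_eq_zero_iff two_ne_zero |>.1 (le_antisymm (by linarith) s2)
  have z1 : ((1) * x 1 + (-35108059/23364169) * x 2 + (11910840/23364169) * x 3) = 0 :=
    pow_eq_zero_iff two_ne_zero |>.1 (le_antisymm (by linarith) s1)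
  have z0 : ((1) * x 0 + (-9803/6543) * x 1 + (6251/6543) * x 2 + (-1003/2181) * x 3) = 0 :=
    pow_eq_zero_iff two_ne_zero |>.1 (le_antisymm (by linarith) s0)
  have y3 : x 3 = 0 := by linarith
  have y2 : x 2 = 0 := by linarith
  have y1 : x 1 = 0 := by linarith
  have y0 : x 0 = 0 := by linarith
  ext i
  fin_cases i <;> simpa

lemma bdf4_ineq (V : Type*) [AddCommGroup V] [Module ℝ V] (b : V →ₗ[ℝ] V →ₗ[ℝ] ℝ)
    (hs : ∀ v w : V, b v w = b w v) (hp : ∀ v : V, 0 ≤ b v v) (w : ℕ → V) :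
    (∑ i : Fin 4, ∑ j : Fin 4, dahlquistG4 i j * b (w (i.1 + 1)) (w (j.1 + 1)))
        - ∑ i : Fin 4, ∑ j : Fin 4, dahlquistG4 i j * b (w i.1) (w j.1)
      ≤ b (∑ i ∈ Finset.range (4 + 1), bdfCoeff 4 i • w (4 - i))
          (w 4 - (39 / 40 : ℝ) • w (4 - 1)) := by
  have c0 : bdfCoeff 4 0 = 25/12 := by
    rw [bdfCoeff_eq]; norm_num [Finset.sum_Icc_succ_top, Nat.choose]
  have c1 : bdfCoeff 4 1 = -4 := by
    rw [bdfCoeff_eq]; norm_num [Finset.sum_Icc_succ_top, Nat.choose]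
  have c2 : bdfCoeff 4 2 = 3 := by
    rw [bdfCoeff_eq]; norm_num [Finset.sum_Icc_succ_top, Nat.choose]
  have c3 : bdfCoeff 4 3 = -4/3 := by
    rw [bdfCoeff_eq]; norm_num [Finset.sum_Icc_succ_top, Nat.choose]
  have c4 : bdfCoeff 4 4 = 1/4 := by
    rw [bdfCoeff_eq]; norm_num [Finset.sum_Icc_succ_top, Nat.choose]
  have h0 := hp ((1 : ℝ) • (w 1 - w 0) + (-3260/6543 : ℝ) • (w 2 - w 1) + (997/2181 : ℝ) • (w 3 - w 2) + (-80/727 : ℝ) • (w 4 - w 3))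
  have h1 := hp ((1 : ℝ) • (w 2 - w 1) + (-2157600/3917489 : ℝ) • (w 3 - w 2) + (-1620927/3917489 : ℝ) • (w 4 - w 3))
  have h2 := hp ((1 : ℝ) • (w 3 - w 2) + (-183445315/660202296 : ℝ) • (w 4 - w 3))
  have h3 := hp ((1 : ℝ) • (w 4 - w 3))
  simp only [map_add, map_sub, map_smul, LinearMap.add_apply, LinearMap.sub_apply,
    LinearMap.smul_apply, smul_eq_mul, hs (w 1) (w 0), hs (w 2) (w 0), hs (w 3) (w 0), hs (w 4) (w 0), hs (w 2) (w 1), hs (w 3) (w 1), hs (w 4) (w 1), hs (w 3) (w 2), hs (w 4) (w 2), hs (w 4) (w 3)] at h0 h1 h2 h3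
  simp [dahlquistG4, Fin.sum_univ_succ, Finset.sum_range_succ, c0, c1, c2, c3, c4, hs (w 1) (w 0), hs (w 2) (w 0), hs (w 3) (w 0), hs (w 4) (w 0), hs (w 2) (w 1), hs (w 3) (w 1), hs (w 4) (w 1), hs (w 3) (w 2), hs (w 4) (w 2), hs (w 4) (w 3)]
  linarith [mul_nonneg (by norm_num : (0:ℝ) ≤ 727/640) h0, mul_nonneg (by norm_num : (0:ℝ) ≤ 3917489/37687680) h1, mul_nonneg (by norm_num : (0:ℝ) ≤ 27508429/235049340) h2, mul_nonneg (by norm_num : (0:ℝ) ≤ 90649048519/950691306240) h3]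

/-- A Dahlquist matrix for BDF-5 with multiplier `η = 39/40`. -/
noncomputable def dahlquistG5 : Matrix (Fin 5) (Fin 5) ℝ :=
  !![36119/36000, -213731/144000, 110927/86400, -54973/43200, 1133/2400;
    -213731/144000, 77323/24000, -1477021/432000, 457/144, -65027/43200;
    110927/86400, -1477021/432000, 3577/720, -2216849/432000, 201073/86400;
    -54973/43200, 457/144, -2216849/432000, 483431/72000, -168853/48000;
    1133/2400, -65027/43200, 201073/86400, -168853/48000, 9009/4000]

lemma dahlquistG5_isSymm : dahlquistG5.IsSymm := by
  ext i j
  fin_cases i <;> fin_cases j <;> simp [dahlquistG5]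

lemma dahlquistG5_posDef : dahlquistG5.PosDef := by
  refine posDef_of_quad dahlquistG5_isSymm fun x hx => ?_
  have key : ∑ i, ∑ j, dahlquistG5 i j * (x i * x j) =
      (36119/36000) * ((1) * x 0 + (-11249/7604) * x 1 + (554635/433428) * x 2 + (-274865/216714) * x 3 + (16995/36119) * x 4) ^ 2 +
      (1123524533/1094976000) * ((1) * x 1 + (-1664059523/1123524533) * x 2 + (4241171230/3370573599) * x 3 + (-2650532020/3370573599) * x 4) ^ 2 +
      (7430131124392001/6916417025148000) * ((1) * x 2 + (-44014889878555799/29720524497568004) * x 3 + (14609220697325835/29720524497568004) * x 4) ^ 2 +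
      (43125046337831851129369/38517799748848133184000) * ((1) * x 3 + (-43204842312669796756729/43125046337831851129369) * x 4) ^ 2 +
      (42375595995492489753709/3450003707026548090349520) * ((1) * x 4) ^ 2 := by
    simp [dahlquistG5, Fin.sum_univ_succ]
    ring
  by_contra hneg
  rw [key] at hneg
  apply hx
  have s0 := sq_nonneg ((1) * x 0 + (-11249/7604) * x 1 + (554635/433428) * x 2 + (-274865/216714) * x 3 + (16995/36119) * x 4)
  have s1 := sq_nonneg ((1) * x 1 + (-1664059523/1123524533) * x 2 + (4241171230/3370573599) * x 3 + (-2650532020/3370573599) * x 4)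
  have s2 := sq_nonneg ((1) * x 2 + (-44014889878555799/29720524497568004) * x 3 + (14609220697325835/29720524497568004) * x 4)
  have s3 := sq_nonneg ((1) * x 3 + (-43204842312669796756729/43125046337831851129369) * x 4)
  have s4 := sq_nonneg ((1) * x 4)
  have z4 : ((1) * x 4) = 0 :=
    pow_eq_zero_iff two_ne_zero |>.1 (le_antisymm (by linarith) s4)
  have z3 : ((1) * x 3 + (-43204842312669796756729/43125046337831851129369) * x 4) = 0 :=
    pow_eq_zero_iff two_ne_zero |>.1 (le_antisymm (by linarith) s3)
  have z2 : ((1) * x 2 + (-44014889878555799/29720524497568004) * x 3 + (14609220697325835/29720524497568004) * x 4) = 0 :=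
    pow_eq_zero_iff two_ne_zero |>.1 (le_antisymm (by linarith) s2)
  have z1 : ((1) * x 1 + (-1664059523/1123524533) * x 2 + (4241171230/3370573599) * x 3 + (-2650532020/3370573599) * x 4) = 0 :=
    pow_eq_zero_iff two_ne_zero |>.1 (le_antisymm (by linarith) s1)
  have z0 : ((1) * x 0 + (-11249/7604) * x 1 + (554635/433428) * x 2 + (-274865/216714) * x 3 + (16995/36119) * x 4) = 0 :=
    pow_eq_zero_iff two_ne_zero |>.1 (le_antisymm (by linarith) s0)
  have y4 : x 4 = 0 := by linarith
  have y3 : x 3 = 0 := by linarith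
  have y2 : x 2 = 0 := by linarith
  have y1 : x 1 = 0 := by linarith
  have y0 : x 0 = 0 := by linarith
  ext i
  fin_cases i <;> simpa

lemma bdf5_ineq (V : Type*) [AddCommGroup V] [Module ℝ V] (b : V →ₗ[ℝ] V →ₗ[ℝ] ℝ)
    (hs : ∀ v w : V, b v w = b w v) (hp : ∀ v : V, 0 ≤ b v v) (w : ℕ → V) :
    (∑ i : Fin 5, ∑ j : Fin 5, dahlquistG5 i j * b (w (i.1 + 1)) (w (j.1 + 1)))
        - ∑ i : Fin 5, ∑ j : Fin 5, dahlquistG5 i j * b (w i.1) (w j.1)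
      ≤ b (∑ i ∈ Finset.range (5 + 1), bdfCoeff 5 i • w (5 - i))
          (w 5 - (39 / 40 : ℝ) • w (5 - 1)) := by
  have c0 : bdfCoeff 5 0 = 137/60 := by
    rw [bdfCoeff_eq]; norm_num [Finset.sum_Icc_succ_top, Nat.choose]
  have c1 : bdfCoeff 5 1 = -5 := by
    rw [bdfCoeff_eq]; norm_num [Finset.sum_Icc_succ_top, Nat.choose]
  have c2 : bdfCoeff 5 2 = 5 := by
    rw [bdfCoeff_eq]; norm_num [Finset.sum_Icc_succ_top, Nat.choose]
  have c3 : bdfCoeff 5 3 = -10/3 := by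
    rw [bdfCoeff_eq]; norm_num [Finset.sum_Icc_succ_top, Nat.choose]
  have c4 : bdfCoeff 5 4 = 5/4 := by
    rw [bdfCoeff_eq]; norm_num [Finset.sum_Icc_succ_top, Nat.choose]
  have c5 : bdfCoeff 5 5 = -1/5 := by
    rw [bdfCoeff_eq]; norm_num [Finset.sum_Icc_succ_top, Nat.choose]
  have h0 := hp ((1 : ℝ) • (w 1 - w 0) + (-3645/7604 : ℝ) • (w 2 - w 1) + (173435/216714 : ℝ) • (w 3 - w 2) + (-16905/36119 : ℝ) • (w 4 - w 3) + (3600/36119 : ℝ) • (w 5 - w 4))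
  have h1 := hp ((1 : ℝ) • (w 2 - w 1) + (-13919970/24929029 : ℝ) • (w 3 - w 2) + (-18033220/74787087 : ℝ) • (w 4 - w 3) + (-5454480/24929029 : ℝ) • (w 5 - w 4))
  have h2 := hp ((1 : ℝ) • (w 3 - w 2) + (-15263199571545/29503750503484 : ℝ) • (w 4 - w 3) + (7883219666355/14751875251742 : ℝ) • (w 5 - w 4))
  have h3 := hp ((1 : ℝ) • (w 4 - w 3) + (-205753232760265530/739371196483987681 : ℝ) • (w 5 - w 4))
  have h4 := hp ((1 : ℝ) • (w 5 - w 4))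
  simp only [map_add, map_sub, map_smul, LinearMap.add_apply, LinearMap.sub_apply,
    LinearMap.smul_apply, smul_eq_mul, hs (w 1) (w 0), hs (w 2) (w 0), hs (w 3) (w 0), hs (w 4) (w 0), hs (w 5) (w 0), hs (w 2) (w 1), hs (w 3) (w 1), hs (w 4) (w 1), hs (w 5) (w 1), hs (w 3) (w 2), hs (w 4) (w 2), hs (w 5) (w 2), hs (w 4) (w 3), hs (w 5) (w 3), hs (w 5) (w 4)] at h0 h1 h2 h3 h4
  simp [dahlquistG5, Fin.sum_univ_succ, Finset.sum_range_succ, c0, c1, c2, c3, c4, c5, hs (w 1) (w 0), hs (w 2) (w 0), hs (w 3) (w 0), hs (w 4) (w 0), hs (w 5) (w 0), hs (w 2) (w 1), hs (w 3) (w 1), hs (w 4) (w 1), hs (w 5) (w 1), hs (w 3) (w 2), hs (w 4) (w 2), hs (w 5) (w 2), hs (w 4) (w 3), hs (w 5) (w 3), hs (w 5) (w 4)]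
  linarith [mul_nonneg (by norm_num : (0:ℝ) ≤ 36119/36000) h0, mul_nonneg (by norm_num : (0:ℝ) ≤ 24929029/1094976000) h1, mul_nonneg (by norm_num : (0:ℝ) ≤ 7375937625871/153463102524000) h2, mul_nonneg (by norm_num : (0:ℝ) ≤ 739371196483987681/38236860652515264000) h3, mul_nonneg (by norm_num : (0:ℝ) ≤ 127856091832323646439/26617363073423556516000) h4]

/-- combined Dahlquist–Nevanlinna–Odeh inequality for BDF methods of
order 1 to 5: for `1 ≤ q ≤ 5` there exist `η ∈ [0,1)` and a symmetric positive definite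
matrix `G ∈ ℝ^{q×q}` such that for every symmetric positive semidefinite bilinear form
`b` on a real vector space `V` and all `w_0, …, w_q ∈ V`,
`b(Σ_{i=0}^q δ_i w_{q−i}, w_q − η w_{q−1}) ≥ Σ_{i,j=1}^q g_{ij} b(w_i,w_j) − Σ_{i,j=1}^q g_{ij} b(w_{i−1},w_{j−1})`. -/
theorem dahlquist_nevanlinna_odeh (q : ℕ) (hq1 : 1 ≤ q) (hq5 : q ≤ 5) :
    ∃ η : ℝ, 0 ≤ η ∧ η < 1 ∧
      ∃ G : Matrix (Fin q) (Fin q) ℝ, G.IsSymm ∧ G.PosDef ∧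
        ∀ (V : Type*) [AddCommGroup V] [Module ℝ V] (b : V →ₗ[ℝ] V →ₗ[ℝ] ℝ),
          (∀ v w : V, b v w = b w v) → (∀ v : V, 0 ≤ b v v) →
          ∀ w : ℕ → V,
            (∑ i : Fin q, ∑ j : Fin q, G i j * b (w (i.1 + 1)) (w (j.1 + 1)))
                - ∑ i : Fin q, ∑ j : Fin q, G i j * b (w i.1) (w j.1)
              ≤ b (∑ i ∈ Finset.range (q + 1), bdfCoeff q i • w (q - i))
                  (w q - η • w (q - 1)) := by
  interval_cases q
  · exact ⟨39 / 40, by norm_num, by norm_num, dahlquistG1, dahlquistG1_isSymm,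
      dahlquistG1_posDef, bdf1_ineq⟩
  · exact ⟨39 / 40, by norm_num, by norm_num, dahlquistG2, dahlquistG2_isSymm,
      dahlquistG2_posDef, bdf2_ineq⟩
  · exact ⟨39 / 40, by norm_num, by norm_num, dahlquistG3, dahlquistG3_isSymm,
      dahlquistG3_posDef, bdf3_ineq⟩
  · exact ⟨39 / 40, by norm_num, by norm_num, dahlquistG4, dahlquistG4_isSymm,
      dahlquistG4_posDef, bdf4_ineq⟩
  · exact ⟨39 / 40, by norm_num, by norm_num, dahlquistG5, dahlquistG5_isSymm,
      dahlquistG5_posDef, bdf5_ineq⟩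
end

section
/- Let 2 ≤ p ≤ q ≤ 5 be integers, let T > 0 and τ > 0 with qτ ≤ T, and let y : ℝ → ℝ be p−1 times continuously differentiable on [0, T]. Assume there is a locally integrable function g : ℝ → ℝ such that y^{(p−1)}(b) − y^{(p−1)}(a) = ∫_a^b g(s) ds for all 0 ≤ a ≤ b ≤ T. Then for every t* ∈ [qτ, T]: y(t*) − Σ_{j=0}^{q−1} γ_j y(t* − (j+1)τ) = τ^p ∫_0^q K̃(s) g(t* − sτ) ds, where K̃(s) = (1/(p−1)!) Σ_{i=0}^{q−1} γ_i (min(s − (i+1), 0))^{p−1} and γ_0,…,γ_{q−1} are the BDF-q extrapolation coefficients. -/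
open MeasureTheory

/-- The BDF-`q` extrapolation coefficients `γ_j`, defined by the polynomial identity
`Σ_{j=0}^{q−1} γ_j ζ^j = (1 − (1−ζ)^q)/ζ`, i.e. `γ_j` is the `(j+1)`-st coefficient of
`1 − (1−ζ)^q`. -/
noncomputable def bdfGamma (q j : ℕ) : ℝ :=
  ((1 - (1 - Polynomial.X) ^ q : Polynomial ℝ)).coeff (j + 1)

lemma bdf_taylor (D : ℕ → ℝ → ℝ) (T : ℝ) (hT : 0 ≤ T) (n : ℕ)
    (H : ∀ k ≤ n, IntervalIntegrable (D (k + 1)) volume 0 T ∧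
      ∀ a ∈ Set.Icc 0 T, ∀ b ∈ Set.Icc 0 T, D k b - D k a = ∫ s in a..b, D (k + 1) s)
    (x₀ x : ℝ) (hx₀ : x₀ ∈ Set.Icc 0 T) (hx : x ∈ Set.Icc 0 T) :
    D 0 x = ∑ k ∈ Finset.range (n + 1), D k x₀ * ((x - x₀) ^ k / (k.factorial : ℝ))
      + ∫ t in x₀..x, ((x - t) ^ n / (n.factorial : ℝ)) * D (n + 1) t := by
  induction n with
  | zero =>
    have := (H 0 le_rfl).2 x₀ hx₀ x hx
    simp at this ⊢
    linarith
  | succ n ih =>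
    rw [ih (fun k hk => H k (by omega)), Finset.sum_range_succ _ (n + 1), add_assoc]
    congr 1
    obtain ⟨hi, hd⟩ := H (n + 1) le_rfl
    have hsub : Set.uIcc x₀ x ⊆ Set.Icc 0 T := Set.ordConnected_Icc.uIcc_subset hx₀ hx
    have hi' : IntervalIntegrable (D (n + 2)) volume x₀ x :=
      hi.mono_set (by rw [Set.uIcc_of_le hT]; exact hsub)
    set f : ℝ → ℝ := fun t => (x - t) ^ (n + 1) / ((n + 1).factorial : ℝ) with hf
    set G : ℝ → ℝ := fun t => ∫ s in x₀..t, D (n + 2) s with hG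
    have hfd : ∀ t, deriv f t = - ((x - t) ^ n / (n.factorial : ℝ)) := by
      intro t
      have h1 : HasDerivAt (fun t : ℝ => x - t) (-1) t := by
        simpa using (hasDerivAt_id t).const_sub x
      have h2 := (h1.pow (n + 1)).div_const ((n + 1).factorial : ℝ)
      have h3 := h2.deriv
      refine h3.trans ?_
      have : (n.factorial : ℝ) ≠ 0 := by positivity
      rw [Nat.factorial_succ]
      push_cast
      field_simp
    have hfac : AbsolutelyContinuousOnInterval f x₀ x := by
      apply ContDiffOn.absolutelyContinuousOnInterval
      fun_prop
    have hGac : AbsolutelyContinuousOnInterval G x₀ x :=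
      hi'.absolutelyContinuousOnInterval_intervalIntegral (by simp)
    have hibp := hfac.integral_mul_deriv_eq_deriv_mul hGac
    have e1 : ∫ t in x₀..x, f t * deriv G t = ∫ t in x₀..x, f t * D (n + 2) t := by
      apply intervalIntegral.integral_congr_ae
      filter_upwards [hi'.ae_hasDerivAt_integral] with t ht ht'
      rw [(ht (Set.uIoc_subset_uIcc ht') x₀ (by simp)).deriv]
    have e2 : ∫ t in x₀..x, deriv f t * G t
        = ∫ t in x₀..x, (deriv f t * D (n + 1) t - deriv f t * D (n + 1) x₀) := by
      apply intervalIntegral.integral_congr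
      intro t ht
      have := hd x₀ hx₀ t (hsub ht)
      simp only [hG]
      rw [← this]; ring
    have hfc : Continuous (deriv f) := by
      rw [funext hfd]; fun_prop
    have hDi : IntervalIntegrable (D (n + 1)) volume x₀ x :=
      (H n (by omega)).1.mono_set (by rw [Set.uIcc_of_le hT]; exact hsub)
    have e3 : ∫ t in x₀..x, deriv f t = f x - f x₀ := hfac.integral_deriv_eq_sub
    rw [intervalIntegral.integral_sub (hDi.continuousOn_mul hfc.continuousOn)
      ((hfc.intervalIntegrable _ _).mul_const _), intervalIntegral.integral_mul_const, e3] at e2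
    have e4 : ∫ t in x₀..x, deriv f t * D (n + 1) t
        = - ∫ t in x₀..x, ((x - t) ^ n / (n.factorial : ℝ)) * D (n + 1) t := by
      rw [← intervalIntegral.integral_neg]
      congr 1; ext t; rw [hfd]; ring
    have hfx : f x = 0 := by simp [hf]
    have hGx : G x₀ = 0 := by simp [hG]
    rw [e1, e2, e4, hfx, hGx] at hibp
    change _ = D (n + 1) x₀ * f x₀ + ∫ t in x₀..x, f t * D (n + 2) t
    rw [hibp]; ring

lemma bdf_moment (q k : ℕ) (hk : k < q) :
    ∑ j ∈ Finset.range q, bdfGamma q j * ((j : ℝ) + 1) ^ k = 0 ^ k := by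
  have h := congrFun (fwdDiff_iter_pow_eq_zero_of_lt (R := ℝ) hk) 0
  rw [fwdDiff_iter_eq_sum_shift, Finset.sum_range_succ'] at h
  have hc : ∀ j < q, bdfGamma q j = - ((-1) ^ (j + 1) * (q.choose (j + 1) : ℝ)) := by
    intro j hj
    have : ((1 - Polynomial.X) ^ q : Polynomial ℝ)
        = ((1 + Polynomial.X) ^ q : Polynomial ℝ).comp (Polynomial.C (-1) * Polynomial.X) := by
      simp [sub_eq_add_neg]
    rw [bdfGamma, this, Polynomial.coeff_sub, Polynomial.comp_C_mul_X_coeff,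
      Polynomial.coeff_one_add_X_pow, Polynomial.coeff_one]
    simp [mul_comm]
  have h' : (-1 : ℝ) ^ q * (0 ^ k - ∑ j ∈ Finset.range q, bdfGamma q j * ((j : ℝ) + 1) ^ k) = 0 := by
    refine Eq.trans ?_ h
    rw [mul_sub, Finset.mul_sum]
    simp only [zero_add]
    rw [add_comm, sub_eq_add_neg, ← Finset.sum_neg_distrib]
    congr 1
    · simp
    · apply Finset.sum_congr rfl
      intro j hj
      have hj := Finset.mem_range.1 hj
      rw [hc j hj]
      have : (-1 : ℝ) ^ q * (-1) ^ (j + 1) = (-1) ^ (q - (j + 1)) := by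
        obtain ⟨m, rfl⟩ := Nat.exists_eq_add_of_le (show j + 1 ≤ q from hj)
        rw [Nat.add_sub_cancel_left, pow_add, mul_right_comm, ← mul_pow]
        simp
      simp only [zsmul_eq_mul, nsmul_eq_mul]
      push_cast
      rw [← this]; ring
  have := (mul_eq_zero.1 h').resolve_left (by simp)
  linarith

lemma bdf_remainder (n q i : ℕ) (hn : n ≠ 0) (hi : i < q) (τ t : ℝ) (hτ : 0 < τ) (g : ℝ → ℝ)
    (hg : LocallyIntegrable g volume) :
    IntervalIntegrable (fun s => (min (s - ((i : ℝ) + 1)) 0) ^ n * g (t - s * τ)) volume 0 q ∧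
    ∫ r in t..(t - (i + 1) * τ), ((t - (i + 1) * τ - r) ^ n / (n.factorial : ℝ)) * g r
     = - τ ^ (n + 1) * ((1 / (n.factorial : ℝ)) * ∫ s in (0 : ℝ)..(q : ℝ),
        (min (s - ((i : ℝ) + 1)) 0) ^ n * g (t - s * τ)) := by
  have hgi : ∀ a b : ℝ, IntervalIntegrable (fun s => g (t - s * τ)) volume a b := by
    intro a b
    have h0 : IntervalIntegrable g volume (t - τ * a) (t - τ * b) :=
      (hg.integrableOn_isCompact isCompact_uIcc).intervalIntegrable
    have h1 := (h0.comp_sub_left t).comp_mul_left (c := τ)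
    simp only [sub_sub_cancel] at h1
    rw [mul_div_cancel_left₀ _ hτ.ne', mul_div_cancel_left₀ _ hτ.ne'] at h1
    simpa [mul_comm] using h1
  have hint : ∀ a b : ℝ, IntervalIntegrable
      (fun s => (min (s - ((i : ℝ) + 1)) 0) ^ n * g (t - s * τ)) volume a b := by
    intro a b
    exact (hgi a b).continuousOn_mul (by fun_prop)
  refine ⟨hint _ _, ?_⟩
  have hiq : (i : ℝ) + 1 ≤ q := by exact_mod_cast hi
  have h2 : ∫ s in ((i : ℝ) + 1)..(q : ℝ), (min (s - ((i : ℝ) + 1)) 0) ^ n * g (t - s * τ) = 0 := by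
    rw [intervalIntegral.integral_congr (g := fun _ => 0)]
    · simp
    · intro s hs
      rw [Set.uIcc_of_le hiq] at hs
      simp [min_eq_right (sub_nonneg.2 hs.1), hn]
  have h1 : ∫ s in (0 : ℝ)..((i : ℝ) + 1), (min (s - ((i : ℝ) + 1)) 0) ^ n * g (t - s * τ)
      = ∫ s in (0 : ℝ)..((i : ℝ) + 1), (s - ((i : ℝ) + 1)) ^ n * g (t - s * τ) := by
    apply intervalIntegral.integral_congr
    intro s hs
    rw [Set.uIcc_of_le (by positivity)] at hs
    simp only
    rw [min_eq_left (sub_nonpos.2 hs.2)]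
  rw [← intervalIntegral.integral_add_adjacent_intervals (hint 0 ((i : ℝ) + 1)) (hint _ _), h1, h2,
    add_zero]
  have hsub := intervalIntegral.integral_comp_sub_mul (a := 0) (b := (i : ℝ) + 1)
    (fun r => ((t - (i + 1) * τ - r) ^ n / (n.factorial : ℝ)) * g r) hτ.ne' t
  rw [intervalIntegral.integral_symm, mul_comm ((i : ℝ) + 1) τ]
  rw [mul_zero, sub_zero, smul_eq_mul, inv_mul_eq_div, eq_div_iff hτ.ne',
    mul_comm ((i : ℝ) + 1) τ] at hsub
  rw [← hsub, ← intervalIntegral.integral_const_mul, ← intervalIntegral.integral_const_mul,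
    ← intervalIntegral.integral_mul_const, ← intervalIntegral.integral_neg]
  congr 1
  ext s
  rw [show t - τ * ((i : ℝ) + 1) - (t - τ * s) = τ * (s - ((i : ℝ) + 1)) by ring, mul_pow,
    mul_comm τ s]
  ring

/-- Peano-kernel representation of the error of the `q`-step extrapolation.
If `y` is `p−1` times continuously differentiable on `[0,T]` (`2 ≤ p ≤ q ≤ 5`) with
`y^{(p−1)}` absolutely continuous with a.e. derivative `g` (a locally integrable
function), then for `t* ∈ [qτ, T]`:
`y(t*) − Σ_{j=0}^{q−1} γ_j y(t*−(j+1)τ) = τ^p ∫_0^q K̃(s) g(t*−sτ) ds`, where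
`K̃(s) = (1/(p−1)!) Σ_{i=0}^{q−1} γ_i (min(s−(i+1),0))^{p−1}`. -/
theorem bdf_extrapolation_peano_kernel (p q : ℕ) (hp : 2 ≤ p) (hpq : p ≤ q) (hq : q ≤ 5)
    (T τ : ℝ) (hT : 0 < T) (hτ : 0 < τ) (hqτT : (q : ℝ) * τ ≤ T)
    (y g : ℝ → ℝ)
    (hy : ContDiffOn ℝ (p - 1) y (Set.Icc 0 T))
    (hg : LocallyIntegrable g volume)
    (hac : ∀ a b : ℝ, 0 ≤ a → a ≤ b → b ≤ T →
      iteratedDerivWithin (p - 1) y (Set.Icc 0 T) b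
          - iteratedDerivWithin (p - 1) y (Set.Icc 0 T) a
        = ∫ s in a..b, g s)
    (tstar : ℝ) (ht1 : (q : ℝ) * τ ≤ tstar) (ht2 : tstar ≤ T) :
    y tstar - (∑ j ∈ Finset.range q, bdfGamma q j * y (tstar - (j + 1) * τ))
      = τ ^ p * ∫ s in (0 : ℝ)..(q : ℝ),
          ((1 / ((p - 1).factorial : ℝ)) *
              ∑ i ∈ Finset.range q, bdfGamma q i * (min (s - (i + 1)) 0) ^ (p - 1)) *
            g (tstar - s * τ) := by
  obtain ⟨n, rfl⟩ : ∃ n, p = n + 1 := ⟨p - 1, by omega⟩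
  simp only [Nat.add_sub_cancel] at hac ⊢
  have hn : n ≠ 0 := by omega
  have hy' : ContDiffOn ℝ n y (Set.Icc 0 T) := by
    convert hy using 1
    change (((n : ℕ) : ℕ∞) : WithTop ℕ∞) = ((((n + 1 : ℕ) : ℕ∞) - 1 : ℕ∞) : WithTop ℕ∞)
    congr 1
  have hu : UniqueDiffOn ℝ (Set.Icc 0 T) := uniqueDiffOn_Icc hT
  set D : ℕ → ℝ → ℝ := fun k =>
    if k ≤ n then iteratedDerivWithin k y (Set.Icc 0 T) else g with hD
  have hDk : ∀ k ≤ n, D k = iteratedDerivWithin k y (Set.Icc 0 T) := by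
    intro k hk; simp [hD, hk]
  have hDn : D (n + 1) = g := by simp [hD]
  have hD0 : D 0 = y := by rw [hDk 0 (by omega)]; simp
  have H : ∀ k ≤ n, IntervalIntegrable (D (k + 1)) volume 0 T ∧
      ∀ a ∈ Set.Icc 0 T, ∀ b ∈ Set.Icc 0 T, D k b - D k a = ∫ s in a..b, D (k + 1) s := by
    intro k hk
    rcases hk.eq_or_lt with rfl | hk
    · rw [hDn, hDk k le_rfl]
      refine ⟨(hg.integrableOn_isCompact isCompact_uIcc).intervalIntegrable, fun a ha b hb => ?_⟩
      rcases le_total a b with h | h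
      · exact hac a b ha.1 h hb.2
      · rw [intervalIntegral.integral_symm, ← hac b a hb.1 h ha.2]; ring
    · rw [hDk k hk.le, hDk (k + 1) hk]
      have hc : ContinuousOn (iteratedDerivWithin (k + 1) y (Set.Icc 0 T)) (Set.Icc 0 T) :=
        hy'.continuousOn_iteratedDerivWithin (by exact_mod_cast hk) hu
      have hd : DifferentiableOn ℝ (iteratedDerivWithin k y (Set.Icc 0 T)) (Set.Icc 0 T) :=
        hy'.differentiableOn_iteratedDerivWithin (by exact_mod_cast hk) hu
      refine ⟨ContinuousOn.intervalIntegrable (by rwa [Set.uIcc_of_le hT.le]),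
        fun a ha b hb => ?_⟩
      have hsub : Set.uIcc a b ⊆ Set.Icc 0 T := Set.ordConnected_Icc.uIcc_subset ha hb
      symm
      apply intervalIntegral.integral_eq_sub_of_hasDeriv_right (hd.continuousOn.mono hsub)
      · intro x hx
        have hx' : x ∈ Set.Ioo 0 T := by
          have h1 := le_min ha.1 hb.1
          have h2 := max_le ha.2 hb.2
          exact ⟨h1.trans_lt hx.1, hx.2.trans_le h2⟩
        have h3 := (hd x (Set.Ioo_subset_Icc_self hx')).hasDerivWithinAt
        rw [iteratedDerivWithin_succ]
        exact (h3.hasDerivAt (Icc_mem_nhds hx'.1 hx'.2)).hasDerivWithinAt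
      · exact (hc.mono hsub).intervalIntegrable
  have hqτ : 0 ≤ (q : ℝ) * τ := by positivity
  have ht0 : tstar ∈ Set.Icc 0 T := ⟨hqτ.trans ht1, ht2⟩
  have hterm : ∀ j ∈ Finset.range q, bdfGamma q j * y (tstar - (j + 1) * τ)
      = ∑ k ∈ Finset.range (n + 1), D k tstar * ((-τ) ^ k / (k.factorial : ℝ)) *
          (bdfGamma q j * ((j : ℝ) + 1) ^ k)
        - τ ^ (n + 1) * ((1 / (n.factorial : ℝ)) * (bdfGamma q j * ∫ s in (0 : ℝ)..(q : ℝ),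
        (min (s - ((j : ℝ) + 1)) 0) ^ n * g (tstar - s * τ))) := by
    intro j hj
    have hj := Finset.mem_range.1 hj
    have hjq : (j : ℝ) + 1 ≤ q := by exact_mod_cast hj
    have hx : tstar - (j + 1) * τ ∈ Set.Icc 0 T := by
      have h1 : ((j : ℝ) + 1) * τ ≤ q * τ := by gcongr
      have h2 : 0 ≤ ((j : ℝ) + 1) * τ := by positivity
      exact ⟨by linarith, by linarith⟩
    have h := bdf_taylor D T hT.le n H tstar _ ht0 hx
    rw [hD0, hDn, (bdf_remainder n q j hn hj τ tstar hτ g hg).2] at h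
    rw [h, mul_add, Finset.mul_sum, sub_eq_add_neg (Finset.sum _ _)]
    congr 1
    · apply Finset.sum_congr rfl
      intro k _
      rw [show tstar - ((j : ℝ) + 1) * τ - tstar = (-τ) * ((j : ℝ) + 1) by ring, mul_pow]
      ring
    · ring
  rw [Finset.sum_congr rfl hterm, Finset.sum_sub_distrib, Finset.sum_comm]
  have hpoly : ∑ k ∈ Finset.range (n + 1), ∑ j ∈ Finset.range q,
      D k tstar * ((-τ) ^ k / (k.factorial : ℝ)) * (bdfGamma q j * ((j : ℝ) + 1) ^ k)
      = y tstar := by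
    rw [Finset.sum_eq_single_of_mem 0 (by simp)]
    · rw [← Finset.mul_sum, bdf_moment q 0 (by omega), hD0]; simp
    · intro k hk hk0
      have := Finset.mem_range.1 hk
      rw [← Finset.mul_sum, bdf_moment q k (by omega), zero_pow hk0, mul_zero]
  rw [hpoly, sub_sub_cancel, ← Finset.mul_sum, ← Finset.mul_sum]
  congr 1
  simp_rw [← intervalIntegral.integral_const_mul]
  rw [← intervalIntegral.integral_finsetSum, ← intervalIntegral.integral_const_mul]
  · congr 1
    ext s
    rw [mul_assoc, Finset.sum_mul]
    simp only [mul_assoc]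
  · intro j hj
    exact ((bdf_remainder n q j hn (Finset.mem_range.1 hj) τ tstar hτ g hg).1).const_mul _
end
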